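/- Let n ≥ 2 and let A be a unital associative algebra over a commutative unital ring R that is 2-torsion free and (n−1)-torsion free, with a nontrivial idempotent e, f = 1 − e, satisfying property (Q), and suppose A = S(A). If either (i) n is even and eAf·fAe = {0} = fAe·eAf, or (ii) eAf = {0} and fAe = {0}, then every Lie n-derivation on A is standard. -/

import Mathlib

open Finset

/-- Iterated commutator: `pCom x k = p_{k+1}(x 0, ..., x k)`, i.e.
`pCom x 0 = x 0` and `pCom x (k+1) = [pCom x k, x (k+1)]`. -/
def pCom {A : Type*} [Ring A] (x : ℕ → A) : ℕ → A
  | 0 => x 0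
  | k + 1 => pCom x k * x (k + 1) - x (k + 1) * pCom x k

/-- `φ` is a Lie `n`-derivation. -/
def IsLieNDeriv {R : Type*} {A : Type*} [CommRing R] [Ring A] [Algebra R A]
    (n : ℕ) (φ : A →ₗ[R] A) : Prop :=
  ∀ x : ℕ → A,
    φ (pCom x (n - 1)) =
      ∑ i ∈ Finset.range n, pCom (Function.update x i (φ (x i))) (n - 1)

/-- `d` is a derivation. -/
def IsDeriv {R : Type*} {A : Type*} [CommRing R] [Ring A] [Algebra R A]
    (d : A →ₗ[R] A) : Prop :=
  ∀ x y : A, d (x * y) = d x * y + x * d y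

/-- `δ` is a Jordan derivation. -/
def IsJordanDeriv {R : Type*} {A : Type*} [CommRing R] [Ring A] [Algebra R A]
    (δ : A →ₗ[R] A) : Prop :=
  ∀ x y : A, δ (x * y + y * x) = δ x * y + y * δ x + x * δ y + δ y * x

/-- `δ` is an antiderivation. -/
def IsAntiDeriv {R : Type*} {A : Type*} [CommRing R] [Ring A] [Algebra R A]
    (δ : A →ₗ[R] A) : Prop :=
  ∀ x y : A, δ (x * y) = δ y * x + y * δ x

/-- `δ` is a singular Jordan derivation relative to the idempotent `e`
(with `f = 1 - e`): it is a Jordan derivation killing `eAe` and `fAf`,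
mapping `eAf` into `fAe` and `fAe` into `eAf`. -/
def IsSingularJordanDeriv {R : Type*} {A : Type*} [CommRing R] [Ring A] [Algebra R A]
    (e : A) (δ : A →ₗ[R] A) : Prop :=
  IsJordanDeriv δ ∧
  (∀ a : A, δ (e * a * e) = 0) ∧
  (∀ b : A, δ ((1 - e) * b * (1 - e)) = 0) ∧
  (∀ m : A, δ (e * m * (1 - e)) = (1 - e) * δ (e * m * (1 - e)) * e) ∧
  (∀ t : A, δ ((1 - e) * t * e) = e * δ ((1 - e) * t * e) * (1 - e))

/-- `z` is a central element. -/
def IsCent {A : Type*} [Ring A] (z : A) : Prop := ∀ y : A, z * y = y * z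

/-- The centre of `A` as a set. -/
def centerSet (A : Type*) [Ring A] : Set A := {z : A | ∀ y : A, z * y = y * z}

/-- `γ` vanishes on all `(n-1)`-th commutators. -/
def VanishesOnNCommutators {R : Type*} {A : Type*} [CommRing R] [Ring A] [Algebra R A]
    (n : ℕ) (γ : A →ₗ[R] A) : Prop :=
  ∀ x : ℕ → A, γ (pCom x (n - 1)) = 0

/-- A Lie `n`-derivation is standard if it is the sum of a derivation and a
central-valued map vanishing on all `(n-1)`-th commutators. -/
def IsStandardLieNDeriv {R : Type*} {A : Type*} [CommRing R] [Ring A] [Algebra R A]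
    (n : ℕ) (φ : A →ₗ[R] A) : Prop :=
  ∃ d γ : A →ₗ[R] A,
    IsDeriv d ∧ (∀ x : A, IsCent (γ x)) ∧ VanishesOnNCommutators n γ ∧ φ = d + γ

/-- Property (Q) for the idempotent `e` (with `f = 1 - e`):
`exe·eAf = 0 = fAe·exe` implies `exe = 0`, and
`eAf·fxf = 0 = fxf·fAe` implies `fxf = 0`. -/
def PropQ {A : Type*} [Ring A] (e : A) : Prop :=
  (∀ x : A,
    ((∀ y : A, (e * x * e) * (e * y * (1 - e)) = 0) ∧
     (∀ y : A, ((1 - e) * y * e) * (e * x * e) = 0)) → e * x * e = 0) ∧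
  (∀ x : A,
    ((∀ y : A, (e * y * (1 - e)) * ((1 - e) * x * (1 - e)) = 0) ∧
     (∀ y : A, ((1 - e) * x * (1 - e)) * ((1 - e) * y * e) = 0)) →
        (1 - e) * x * (1 - e) = 0)

/-- `A` is `k`-torsion free. -/
def TorsionFreeAt (A : Type*) [Ring A] (k : ℕ) : Prop :=
  ∀ x : A, k • x = 0 → x = 0

/-- The centre of the corner algebra `gAg` (for an idempotent `g`). -/
def cornerCenter {A : Type*} [Ring A] (g : A) : Set A :=
  {z : A | z = g * z * g ∧ ∀ a : A, z * (g * a * g) = (g * a * g) * z}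

/-- The corner algebra `gAg` has no nonzero central ideal: every
ideal of `gAg` consisting of elements central in `gAg` is zero. -/
def NoNonzeroCentralIdeal (R : Type*) [CommRing R] (A : Type*) [Ring A] [Algebra R A]
    (g : A) : Prop :=
  ∀ I : Set A, (0 : A) ∈ I →
    (∀ x ∈ I, x = g * x * g) →
    (∀ x ∈ I, ∀ y ∈ I, x + y ∈ I) →
    (∀ r : R, ∀ x ∈ I, r • x ∈ I) →
    (∀ x ∈ I, ∀ a : A, (g * a * g) * x ∈ I) →
    (∀ x ∈ I, ∀ a : A, x * (g * a * g) ∈ I) →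
    (∀ x ∈ I, ∀ a : A, x * (g * a * g) = (g * a * g) * x) →
    ∀ x ∈ I, x = 0

/-- The generating set of `S(gAg)`: all idempotents of `gAg` together with all
commutators of elements of `gAg`. -/
def cornerGenSet {A : Type*} [Ring A] (g : A) : Set A :=
  {x : A | x = g * x * g ∧ x * x = x} ∪
  {x : A | ∃ a b : A, x = (g * a * g) * (g * b * g) - (g * b * g) * (g * a * g)}

/-- `gAg = S(gAg)`: the corner algebra is generated (as an algebra) by its
idempotents and commutators. -/
def CornerGenerated (R : Type*) [CommRing R] {A : Type*} [Ring A] [Algebra R A]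
    (g : A) : Prop :=
  ∀ x : A, g * x * g ∈ NonUnitalAlgebra.adjoin R (cornerGenSet g)

/-- Condition (*) for the corner algebra `gAg`: if `[x, gAg] ⊆ Z(gAg)` then
`x ∈ Z(gAg)`. -/
def CornerCondStar {A : Type*} [Ring A] (g : A) : Prop :=
  ∀ x : A, x = g * x * g →
    (∀ a : A, x * (g * a * g) - (g * a * g) * x ∈ cornerCenter g) →
    x ∈ cornerCenter g

/-- Peirce off-diagonal elements relative to `e`, i.e. members of `eA(1-e) + (1-e)Ae`. -/
def OffDiag {A : Type*} [Ring A] (e u : A) : Prop := e * u + u * e = u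

section OffDiag

variable {A : Type*} [Ring A] {e u v : A}

lemma OffDiag.corner (he : e * e = e) (hu : OffDiag e u) : e * u * e = 0 := by
  have h := congrArg (e * ·) hu
  simpa [mul_add, ← mul_assoc, he] using h

lemma OffDiag.compl (hu : OffDiag e u) : OffDiag (1 - e) u := by
  unfold OffDiag at *
  linear_combination (norm := noncomm_ring) -hu

lemma offDiag_compl_iff : OffDiag (1 - e) u ↔ OffDiag e u :=
  ⟨fun h => by simpa using h.compl, OffDiag.compl⟩

lemma OffDiag.add (hu : OffDiag e u) (hv : OffDiag e v) : OffDiag e (u + v) := by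
  unfold OffDiag at *
  linear_combination (norm := noncomm_ring) hu + hv

lemma OffDiag.sub (hu : OffDiag e u) (hv : OffDiag e v) : OffDiag e (u - v) := by
  unfold OffDiag at *
  linear_combination (norm := noncomm_ring) hu - hv

lemma offDiag_of_mul_left (h₁ : e * u = u) (h₂ : u * e = 0) : OffDiag e u := by
  simp [OffDiag, h₁, h₂]

lemma offDiag_of_mul_right (h₁ : e * u = 0) (h₂ : u * e = u) : OffDiag e u := by
  simp [OffDiag, h₁, h₂]

lemma offDiag_corner_left (he : e * e = e) (x : A) : OffDiag e (e * x * (1 - e)) :=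
  offDiag_of_mul_left (by simp [← mul_assoc, he]) (by simp [mul_assoc, sub_mul, he])

lemma offDiag_corner_right (he : e * e = e) (x : A) : OffDiag e ((1 - e) * x * e) :=
  offDiag_of_mul_right (by simp [← mul_assoc, mul_sub, he]) (by simp [mul_assoc, he])

lemma offDiag_commutator (he : e * e = e) (x : A) : OffDiag e (x * e - e * x) := by
  unfold OffDiag
  linear_combination (norm := noncomm_ring) x * he - he * x

lemma OffDiag.commutator_commutator (he : e * e = e) (hu : OffDiag e u) :
    (u * e - e * u) * e - e * (u * e - e * u) = u := by
  have h := hu.corner he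
  unfold OffDiag at hu
  linear_combination (norm := noncomm_ring) u * he + he * u - 2 * h + hu

lemma OffDiag.eq_zero_of_commute (he : e * e = e) (hu : OffDiag e u) (h : u * e - e * u = 0) :
    u = 0 := by
  rw [← hu.commutator_commutator he, h]; simp

lemma OffDiag.mul_eq_zero (he : e * e = e)
    (H : ∀ m t : A, (e * m * (1 - e)) * ((1 - e) * t * e) = 0 ∧
      ((1 - e) * t * e) * (e * m * (1 - e)) = 0)
    (hu : OffDiag e u) (hv : OffDiag e v) : u * v = 0 := by
  have hu0 := hu.corner he
  have hv0 := hv.corner he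
  have hf : (1 - e) * (1 - e) = 1 - e := by
    linear_combination (norm := noncomm_ring) he
  have hu1 : e * u * (1 - e) = e * u := by
    linear_combination (norm := noncomm_ring) -hu0
  have hu2 : (1 - e) * u * e = u * e := by
    linear_combination (norm := noncomm_ring) -hu0
  have hv1 : e * v * (1 - e) = e * v := by
    linear_combination (norm := noncomm_ring) -hv0
  have hv2 : (1 - e) * v * e = v * e := by
    linear_combination (norm := noncomm_ring) -hv0
  have h1 := (H u v).1
  have h2 := (H v u).2
  rw [hu1, hv2] at h1
  rw [hu2, hv1] at h2
  have h3 : (e * u) * (e * v) = 0 := by rw [← mul_assoc, hu0, zero_mul]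
  have h4 : (u * e) * (v * e) = 0 := by rw [mul_assoc, ← mul_assoc e, hv0, mul_zero]
  unfold OffDiag at hu hv
  rw [← hu, ← hv, add_mul, mul_add, mul_add, h1, h2, h3, h4]
  simp

lemma OffDiag.mul_left (he : e * e = e)
    (H : ∀ u v : A, OffDiag e u → OffDiag e v → u * v = 0)
    (hu : OffDiag e u) (y : A) : OffDiag e (y * u) := by
  have h := H _ _ (offDiag_commutator he y) hu
  unfold OffDiag at *
  linear_combination (norm := noncomm_ring) y * hu - h

lemma OffDiag.mul_right (he : e * e = e)
    (H : ∀ u v : A, OffDiag e u → OffDiag e v → u * v = 0)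
    (hu : OffDiag e u) (y : A) : OffDiag e (u * y) := by
  have h := H _ _ hu (offDiag_commutator he y)
  unfold OffDiag at *
  linear_combination (norm := noncomm_ring) hu * y + h

lemma offDiag_of_corners (h₁ : e * v * e = 0) (h₂ : (1 - e) * v * (1 - e) = 0) :
    OffDiag e v := by
  unfold OffDiag
  linear_combination (norm := noncomm_ring) h₁ - h₂

lemma PropQ.offDiag_of_annihilates (he : e * e = e) (hQ : PropQ e)
    (h : ∀ u, OffDiag e u → v * u = 0 ∧ u * v = 0) : OffDiag e v := by
  have hf : (1 - e) * (1 - e) = 1 - e := by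
    linear_combination (norm := noncomm_ring) he
  have hl := fun y => h _ (offDiag_corner_left he y)
  have hr := fun y => h _ (offDiag_corner_right he y)
  refine offDiag_of_corners (hQ.1 v ⟨fun y => ?_, fun y => ?_⟩) (hQ.2 v ⟨fun y => ?_, fun y => ?_⟩)
  · have := congrArg (e * ·) (hl y).1
    simpa [mul_assoc, ← mul_assoc e e, he] using this
  · have := congrArg (· * e) (hr y).2
    simpa [mul_assoc, ← mul_assoc e e, he] using this
  · have := congrArg (· * (1 - e)) (hl y).2
    simpa only [mul_assoc, ← mul_assoc (1 - e) (1 - e), hf, zero_mul] using this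
  · have := congrArg ((1 - e) * ·) (hr y).1
    simpa only [mul_assoc, ← mul_assoc (1 - e) (1 - e), hf, mul_zero] using this

/-- Every element is the sum of an element commuting with `e` and an off-diagonal one. -/
lemma exists_diag_add_offDiag (he : e * e = e) (x : A) :
    ∃ y u, y * e = e * y ∧ OffDiag e u ∧ x = y + u := by
  refine ⟨e * x * e + (1 - e) * x * (1 - e), e * x * (1 - e) + (1 - e) * x * e, ?_,
    (offDiag_corner_left he x).add (offDiag_corner_right he x), by noncomm_ring⟩
  linear_combination (norm := noncomm_ring) 2 * e * x * he - 2 * he * x * e - x * he + he * x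

/-- An element commuting with `e` and with the off-diagonal part is central. -/
lemma isCent_of_commute_offDiag (he : e * e = e)
    (H : ∀ u v : A, OffDiag e u → OffDiag e v → u * v = 0)
    (hann : ∀ v : A, (∀ u, OffDiag e u → v * u = 0 ∧ u * v = 0) → OffDiag e v)
    {w : A} (hw : w * e = e * w) (h : ∀ u, OffDiag e u → w * u = u * w) : IsCent w := by
  intro x
  obtain ⟨y, v, hy, hv, rfl⟩ := exists_diag_add_offDiag he x
  have h0 : w * y - y * w = 0 := by
    refine (hann _ fun u hu => ⟨?_, ?_⟩).eq_zero_of_commute he ?_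
    · linear_combination (norm := noncomm_ring) h _ (hu.mul_left he H y) - y * h u hu
    · linear_combination (norm := noncomm_ring) h _ (hu.mul_right he H y) - h u hu * y
    · linear_combination (norm := noncomm_ring) w * hy + hw * y - y * hw - hy * w
  linear_combination (norm := noncomm_ring) h0 + h v hv

end OffDiag

/-- A linear map which commutes with `[·, e]` and behaves like a Lie derivation on commutators
with off-diagonal elements, on an algebra whose off-diagonal part is a square-zero ideal
containing its own annihilator. -/
structure OffDiagLie {R A : Type*} [CommRing R] [Ring A] [Algebra R A]
    (e : A) (φ : A →ₗ[R] A) : Prop where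
  idem : e * e = e
  two : TorsionFreeAt A 2
  mul_zero : ∀ u v : A, OffDiag e u → OffDiag e v → u * v = 0
  ann : ∀ v : A, (∀ u, OffDiag e u → v * u = 0 ∧ u * v = 0) → OffDiag e v
  map_comm : ∀ x, φ (x * e - e * x) = φ x * e - e * φ x
  rule : ∀ x u, OffDiag e u →
    φ (x * u - u * x) = φ x * u - u * φ x + (x * φ u - φ u * x)

/-- The failure of `φ` to satisfy the Leibniz rule at `(x, u)` with `u` off-diagonal is given by
multiplication by an element commuting with the off-diagonal part. -/
def DefectMul {R A : Type*} [CommRing R] [Ring A] [Algebra R A]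
    (e : A) (φ : A →ₗ[R] A) (x : A) : Prop :=
  ∃ h : A, ∀ u, OffDiag e u →
    φ x * u + x * φ u - φ (x * u) = h * u ∧ φ x * u + x * φ u - φ (x * u) = u * h

namespace OffDiagLie

variable {R A : Type*} [CommRing R] [Ring A] [Algebra R A] {e : A} {φ : A →ₗ[R] A}

lemma compl (H : OffDiagLie e φ) : OffDiagLie (1 - e) φ where
  idem := by linear_combination (norm := noncomm_ring) H.idem
  two := H.two
  mul_zero u v hu hv := H.mul_zero u v (offDiag_compl_iff.1 hu) (offDiag_compl_iff.1 hv)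
  ann v h := (H.ann v fun u hu => h u hu.compl).compl
  map_comm x := by
    have h1 : x * (1 - e) - (1 - e) * x = -(x * e - e * x) := by noncomm_ring
    rw [h1, map_neg, H.map_comm]; noncomm_ring
  rule x u hu := H.rule x u (offDiag_compl_iff.1 hu)

lemma mul_left (H : OffDiagLie e φ) {u : A} (hu : OffDiag e u) (y : A) : OffDiag e (y * u) :=
  hu.mul_left H.idem H.mul_zero y

lemma mul_right (H : OffDiagLie e φ) {u : A} (hu : OffDiag e u) (y : A) : OffDiag e (u * y) :=
  hu.mul_right H.idem H.mul_zero y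

lemma map_offDiag (H : OffDiagLie e φ) {u : A} (hu : OffDiag e u) : OffDiag e (φ u) := by
  rw [← hu.commutator_commutator H.idem, H.map_comm]
  exact offDiag_commutator H.idem _

lemma map_commute (H : OffDiagLie e φ) {x : A} (hx : x * e = e * x) : φ x * e = e * φ x := by
  have := H.map_comm x
  rw [hx, sub_self, map_zero] at this
  exact (sub_eq_zero.1 this.symm)

lemma map_left (H : OffDiagLie e φ) {m : A} (h₁ : e * m = m) (h₂ : m * e = 0) :
    e * φ m = φ m ∧ φ m * e = 0 := by
  have hv := H.map_offDiag (offDiag_of_mul_left h₁ h₂)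
  have h := H.map_comm m
  rw [h₁, h₂, zero_sub, map_neg] at h
  unfold OffDiag at hv
  have h0 : φ m * e = 0 := by
    apply H.two
    rw [two_smul]
    linear_combination (norm := noncomm_ring) -h + hv
  exact ⟨by rwa [h0, add_zero] at hv, h0⟩

lemma map_right (H : OffDiagLie e φ) {t : A} (h₁ : e * t = 0) (h₂ : t * e = t) :
    e * φ t = 0 ∧ φ t * e = φ t := by
  have hv := H.map_offDiag (offDiag_of_mul_right h₁ h₂)
  have h := H.map_comm t
  rw [h₁, h₂, sub_zero] at h
  unfold OffDiag at hv
  have h0 : e * φ t = 0 := by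
    apply H.two
    rw [two_smul]
    linear_combination (norm := noncomm_ring) h + hv
  exact ⟨h0, by rwa [h0, zero_add] at hv⟩

/-- The defect can be computed with the off-diagonal element on the left. -/
lemma defect_eq (H : OffDiagLie e φ) (x : A) {u : A} (hu : OffDiag e u) :
    φ x * u + x * φ u - φ (x * u) = u * φ x + φ u * x - φ (u * x) := by
  have := H.rule x u hu
  rw [map_sub] at this
  linear_combination (norm := noncomm_ring) -this

lemma defectMul_mul (H : OffDiagLie e φ) {x y : A} (hx : DefectMul e φ x)
    (hy : DefectMul e φ y) : DefectMul e φ (x * y) := by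
  obtain ⟨h, hh⟩ := hx
  obtain ⟨k, hk⟩ := hy
  refine ⟨φ (x * y) - φ x * y - x * φ y + x * k + h * y, fun u hu => ⟨?_, ?_⟩⟩
  · have h1 := (hh _ (H.mul_left hu y)).1
    have h2 := (hk u hu).1
    rw [mul_assoc x y u]
    linear_combination (norm := noncomm_ring) h1 + x * h2
  · have h1 := (hk _ (H.mul_right hu x)).2
    have h2 := (hh u hu).2
    rw [H.defect_eq _ (H.mul_right hu x)] at h1
    rw [H.defect_eq _ hu] at h2 ⊢
    rw [← mul_assoc u x y]
    linear_combination (norm := noncomm_ring) h1 + h2 * y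

lemma defectMul_add {x y : A} (hx : DefectMul e φ x)
    (hy : DefectMul e φ y) : DefectMul e φ (x + y) := by
  obtain ⟨h, hh⟩ := hx
  obtain ⟨k, hk⟩ := hy
  refine ⟨h + k, fun u hu => ⟨?_, ?_⟩⟩
  · rw [add_mul x y u, map_add, map_add]
    linear_combination (norm := noncomm_ring) (hh u hu).1 + (hk u hu).1
  · rw [add_mul x y u, map_add, map_add]
    linear_combination (norm := noncomm_ring) (hh u hu).2 + (hk u hu).2

lemma defectMul_smul (r : R) {x : A} (hx : DefectMul e φ x) : DefectMul e φ (r • x) := by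
  obtain ⟨h, hh⟩ := hx
  refine ⟨r • h, fun u hu => ⟨?_, ?_⟩⟩
  · simp only [smul_mul_assoc, map_smul, ← (hh u hu).1, smul_sub, smul_add]
  · simp only [smul_mul_assoc, mul_smul_comm, map_smul, ← (hh u hu).2, smul_sub, smul_add]

lemma defectMul_of_offDiag (H : OffDiagLie e φ) {x : A} (hx : OffDiag e x) :
    DefectMul e φ x := by
  refine ⟨0, fun u hu => ?_⟩
  rw [H.mul_zero _ _ (H.map_offDiag hx) hu, H.mul_zero _ _ hx (H.map_offDiag hu),
    H.mul_zero _ _ hx hu]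
  simp

lemma map_mul_left (H : OffDiagLie e φ) {x m : A} (hx : x = e * x)
    (h₁ : e * m = m) (h₂ : m * e = 0) :
    φ (x * m) = φ x * m - m * φ x + x * φ m := by
  have h := H.rule x m (offDiag_of_mul_left h₁ h₂)
  have h3 : m * x = 0 := by rw [hx, ← mul_assoc, h₂, zero_mul]
  have h4 : φ m * x = 0 := by rw [hx, ← mul_assoc, (H.map_left h₁ h₂).2, zero_mul]
  rwa [h3, h4, sub_zero, sub_zero] at h

lemma map_mul_right (H : OffDiagLie e φ) {x t : A} (hx : x = x * e)
    (h₁ : e * t = 0) (h₂ : t * e = t) :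
    φ (t * x) = t * φ x - φ x * t + φ t * x := by
  have h := H.rule x t (offDiag_of_mul_right h₁ h₂)
  have h3 : x * t = 0 := by rw [hx, mul_assoc, h₁, MulZeroClass.mul_zero]
  have h4 : x * φ t = 0 := by
    rw [hx, mul_assoc, (H.map_right h₁ h₂).1, MulZeroClass.mul_zero]
  rw [h3, h4, zero_sub, zero_sub, map_neg] at h
  linear_combination (norm := noncomm_ring) -h

lemma mul_map_mul (H : OffDiagLie e φ) {x y m : A} (hx : x = e * x) (hy : y = e * y)
    (h₁ : e * m = m) (h₂ : m * e = 0) :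
    m * φ (x * y) =
      (φ (x * y) - φ x * y - x * φ y) * m + y * m * φ x + x * m * φ y := by
  have a := H.map_mul_left (x := x * y) (by rw [← mul_assoc, ← hx]) h₁ h₂
  have b := H.map_mul_left (m := y * m) hx (by rw [← mul_assoc, ← hy])
    (by rw [mul_assoc, h₂, MulZeroClass.mul_zero])
  have c := H.map_mul_left hy h₁ h₂
  rw [c, ← mul_assoc x y m, a] at b
  linear_combination (norm := noncomm_ring) -b

lemma map_mul_mul (H : OffDiagLie e φ) {x y t : A} (hx : x = x * e) (hy : y = y * e)
    (h₁ : e * t = 0) (h₂ : t * e = t) :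
    φ (x * y) * t =
      t * (φ (x * y) - φ x * y - x * φ y) + φ x * t * y + φ y * t * x := by
  have a := H.map_mul_right (x := x * y) (by rw [mul_assoc, ← hy]) h₁ h₂
  have b := H.map_mul_right (t := t * x) hy (by rw [← mul_assoc, h₁, zero_mul])
    (by rw [mul_assoc, ← hx])
  have c := H.map_mul_right hx h₁ h₂
  rw [c, mul_assoc t x y, a] at b
  linear_combination (norm := noncomm_ring) -b

lemma defectMul_of_corner (H : OffDiagLie e φ) {x : A} (hx₁ : x = e * x) (hx₂ : x = x * e)
    (k : A) (hm : ∀ m, e * m = m → m * e = 0 → m * φ x = k * m)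
    (ht : ∀ t, e * t = 0 → t * e = t → φ x * t = t * k) : DefectMul e φ x := by
  have hc := H.map_commute (hx₂.symm.trans hx₁)
  have he := H.idem
  refine ⟨e * k * e + (1 - e) * φ x * (1 - e), fun u hu => ?_⟩
  have h0 := hu.corner he
  obtain ⟨m, t, m₁, m₂, t₁, t₂, rfl⟩ :
      ∃ m t, e * m = m ∧ m * e = 0 ∧ e * t = 0 ∧ t * e = t ∧ u = m + t :=
    ⟨e * u, u * e, by rw [← mul_assoc, he], h0, by rw [← mul_assoc, h0],
      by rw [mul_assoc, he], hu.symm⟩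
  have a := H.map_mul_left hx₁ m₁ m₂
  have b : x * t = 0 := by rw [hx₂, mul_assoc, t₁, MulZeroClass.mul_zero]
  have c : x * φ t = 0 := by
    rw [hx₂, mul_assoc, (H.map_right t₁ t₂).1, MulZeroClass.mul_zero]
  have hm := hm m m₁ m₂
  have ht := ht t t₁ t₂
  have hg : φ x * (m + t) + x * φ (m + t) - φ (x * (m + t)) = m * φ x + φ x * t := by
    rw [mul_add x, b, map_add, mul_add x, c, add_zero, add_zero, a]
    noncomm_ring
  have e1 : e * k * m = m * φ x := by rw [mul_assoc, ← hm, ← mul_assoc, m₁]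
  have e2 : t * k * e = φ x * t := by rw [← ht, mul_assoc, t₂]
  have e3 : (1 - e) * φ x = φ x * (1 - e) := by
    linear_combination (norm := noncomm_ring) hc
  have e4 : (1 - e) * (1 - e) = 1 - e := by
    linear_combination (norm := noncomm_ring) he
  have e5 : (1 - e) * φ x * (1 - e) = φ x * (1 - e) := by rw [e3, mul_assoc, e4]
  have e6 : (1 - e) * φ x * (1 - e) = (1 - e) * φ x := by rw [e5, e3]
  rw [hg]
  constructor
  · rw [e5]
    linear_combination (norm := noncomm_ring) -e1 - e * k * m₁ + e1 - e * k * t₁ + φ x * m₁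
      + φ x * t₁ - e1
  · rw [e6]
    linear_combination (norm := noncomm_ring) -e2 - m₂ * k * e - t₂ * k * e + e2 + m₂ * φ x
      + t₂ * φ x - e2

lemma corner_mul (H : OffDiagLie e φ) (x y : A) :
    e * (x * y) * e = (e * x * e) * (e * y * e) := by
  have h := H.mul_zero _ _ (offDiag_corner_left H.idem x) (offDiag_corner_right H.idem y)
  have hf : (1 - e) * (1 - e) = 1 - e := by
    linear_combination (norm := noncomm_ring) H.idem
  have h1 : e * x * ((1 - e) * (1 - e)) * y * e = 0 := by
    simpa only [mul_assoc] using h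
  rw [hf] at h1
  have h2 : (e * x * e) * (e * y * e) = e * x * (e * e) * y * e := by
    simp only [mul_assoc]
  rw [h2, H.idem]
  linear_combination (norm := noncomm_ring) h1

lemma defectMul_corner (H : OffDiagLie e φ)
    (hSA : ∀ x : A, x ∈ NonUnitalAlgebra.adjoin R
      ({y : A | y * y = y} ∪ {y : A | ∃ a b : A, y = a * b - b * a}))
    (x : A) : DefectMul e φ (e * x * e) := by
  have cl : ∀ y, e * y * e = e * (e * y * e) := fun y => by simp only [← mul_assoc, H.idem]
  have cr : ∀ y, e * y * e = e * y * e * e := fun y => by simp only [mul_assoc, H.idem]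
  induction hSA x using NonUnitalAlgebra.adjoin_induction with
  | mem x hx =>
    rcases hx with hx | ⟨a, b, rfl⟩
    · have hp := H.corner_mul x x
      have hx : x * x = x := hx
      rw [hx] at hp
      have l := cl x
      have r := cr x
      generalize e * x * e = p at *
      have hh : (φ p - φ p * p - p * φ p) * p = p * (φ p - φ p * p - p * φ p) := by
        linear_combination (norm := noncomm_ring) φ p * hp - hp * φ p
      refine H.defectMul_of_corner l r
        ((φ p - φ p * p - p * φ p) - 2 * ((φ p - φ p * p - p * φ p) * p)) ?_ ?_
      · intro m m₁ m₂
        have a := H.mul_map_mul l l m₁ m₂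
        have b := H.mul_map_mul (m := p * m) l l (by rw [← mul_assoc, ← l])
          (by rw [mul_assoc, m₂, MulZeroClass.mul_zero])
        rw [← hp] at a b
        have c : p * (p * m) = p * m := by rw [← mul_assoc, ← hp]
        rw [c] at b
        linear_combination (norm := noncomm_ring) a - 2 * b
      · intro t t₁ t₂
        have a := H.map_mul_mul r r t₁ t₂
        have b := H.map_mul_mul (t := t * p) r r (by rw [← mul_assoc, t₁, zero_mul])
          (by rw [mul_assoc, ← r])
        rw [← hp] at a b
        have c : φ p * (t * p) * p = φ p * (t * p) := by rw [mul_assoc, mul_assoc t, ← hp]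
        rw [c] at b
        rw [hh]
        linear_combination (norm := noncomm_ring) a - 2 * b
    · rw [show e * (a * b - b * a) * e = e * (a * b) * e - e * (b * a) * e by noncomm_ring,
        H.corner_mul, H.corner_mul]
      have al := cl a
      have ar := cr a
      have bl := cl b
      have br := cr b
      generalize e * a * e = a at *
      generalize e * b * e = b at *
      refine H.defectMul_of_corner
        (by rw [mul_sub, ← mul_assoc, ← mul_assoc, ← al, ← bl])
        (by rw [sub_mul, mul_assoc, mul_assoc, ← ar, ← br])
        ((φ (a * b) - φ a * b - a * φ b) - (φ (b * a) - φ b * a - b * φ a)) ?_ ?_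
      · intro m m₁ m₂
        rw [map_sub, mul_sub, H.mul_map_mul al bl m₁ m₂, H.mul_map_mul bl al m₁ m₂]
        noncomm_ring
      · intro t t₁ t₂
        rw [map_sub, sub_mul, H.map_mul_mul ar br t₁ t₂, H.map_mul_mul br ar t₁ t₂]
        noncomm_ring
  | zero => exact ⟨0, by simp⟩
  | add x y _ _ hx hy =>
    rw [mul_add, add_mul]
    exact defectMul_add hx hy
  | mul x y _ _ hx hy =>
    rw [H.corner_mul]
    exact H.defectMul_mul hx hy
  | smul r x _ hx =>
    rw [mul_smul_comm, smul_mul_assoc]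
    exact defectMul_smul r hx

lemma defectMul (H : OffDiagLie e φ)
    (hSA : ∀ x : A, x ∈ NonUnitalAlgebra.adjoin R
      ({y : A | y * y = y} ∪ {y : A | ∃ a b : A, y = a * b - b * a}))
    (x : A) : DefectMul e φ x := by
  have h₁ := H.defectMul_corner hSA x
  obtain ⟨k, hk⟩ := H.compl.defectMul_corner hSA x
  have h₂ : DefectMul e φ ((1 - e) * x * (1 - e)) := ⟨k, fun u hu => hk u hu.compl⟩
  have h₃ := H.defectMul_of_offDiag (offDiag_corner_left H.idem x)
  have h₄ := H.defectMul_of_offDiag (offDiag_corner_right H.idem x)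
  rw [show x = e * x * e + (1 - e) * x * (1 - e) + e * x * (1 - e) + (1 - e) * x * e by
    noncomm_ring]
  exact defectMul_add (defectMul_add (defectMul_add h₁ h₂) h₃) h₄

lemma eq_zero_of_annihilates (H : OffDiagLie e φ) {v : A} (hv : v * e = e * v)
    (h : ∀ u, OffDiag e u → v * u = 0 ∧ u * v = 0) : v = 0 :=
  (H.ann v h).eq_zero_of_commute H.idem (sub_eq_zero.2 hv)

lemma exists_central (H : OffDiagLie e φ) {x : A} (hx : DefectMul e φ x) :
    ∃ z, IsCent z ∧ ∀ u, OffDiag e u → φ x * u + x * φ u - φ (x * u) = z * u := by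
  obtain ⟨h, hh⟩ := hx
  obtain ⟨z, v, hz, hv, rfl⟩ := exists_diag_add_offDiag H.idem h
  have hl : ∀ u, OffDiag e u → φ x * u + x * φ u - φ (x * u) = z * u := fun u hu => by
    rw [(hh u hu).1, add_mul, H.mul_zero v u hv hu, add_zero]
  refine ⟨z, isCent_of_commute_offDiag H.idem H.mul_zero H.ann hz fun u hu => ?_, hl⟩
  rw [← hl u hu, (hh u hu).2, mul_add, H.mul_zero u v hu hv, add_zero]

lemma central_unique (H : OffDiagLie e φ) {z w : A} (hz : IsCent z) (hw : IsCent w)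
    (h : ∀ u, OffDiag e u → z * u = w * u) : z = w := by
  refine sub_eq_zero.1 (H.eq_zero_of_annihilates ?_ fun u hu => ⟨?_, ?_⟩)
  · rw [sub_mul, mul_sub, hz e, hw e]
  · rw [sub_mul, h u hu, sub_self]
  · rw [mul_sub, ← hz u, ← hw u, h u hu, sub_self]

/-- `φ` is the sum of a derivation and a central-valued linear map. -/
theorem exists_deriv_add_central (H : OffDiagLie e φ)
    (hSA : ∀ x : A, x ∈ NonUnitalAlgebra.adjoin R
      ({y : A | y * y = y} ∪ {y : A | ∃ a b : A, y = a * b - b * a})) :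
    ∃ d γ : A →ₗ[R] A, IsDeriv d ∧ (∀ x, IsCent (γ x)) ∧ φ = d + γ := by
  choose g hc hg using fun x => H.exists_central (H.defectMul hSA x)
  let γ : A →ₗ[R] A :=
    { toFun := g
      map_add' := fun x y => H.central_unique (hc _)
        (fun a => by rw [add_mul, mul_add, hc x, hc y]) fun u hu => by
          rw [← hg _ u hu, add_mul (g x), ← hg x u hu, ← hg y u hu, add_mul x y u, map_add, map_add]
          noncomm_ring
      map_smul' := fun r x => H.central_unique (hc _)
        (fun a => by rw [RingHom.id_apply, smul_mul_assoc, mul_smul_comm, hc x]) fun u hu => by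
          simp only [RingHom.id_apply, smul_mul_assoc, ← hg _ u hu, map_smul, smul_sub, smul_add] }
  have hγ : ∀ x, γ x = g x := fun _ => rfl
  have hγu : ∀ u, OffDiag e u → γ u = 0 := fun u hu =>
    H.central_unique (hc _) (fun a => by simp) fun v hv => by
      rw [hγ, ← hg u v hv, H.mul_zero _ _ (H.map_offDiag hu) hv,
        H.mul_zero _ _ hu (H.map_offDiag hv), H.mul_zero _ _ hu hv]
      simp
  refine ⟨φ - γ, γ, ?_, hc, by simp⟩
  generalize hd : φ - γ = d
  have hdx : ∀ x, d x = φ x - g x := fun x => by rw [← hd]; rfl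
  have hdu : ∀ u, OffDiag e u → d u = φ u := fun u hu => by
    rw [hdx, ← hγ, hγu u hu, sub_zero]
  have hl : ∀ x u, OffDiag e u → d (x * u) = d x * u + x * d u := fun x u hu => by
    rw [hdu _ (H.mul_left hu x), hdu u hu, hdx]
    linear_combination (norm := noncomm_ring) -hg x u hu
  have hr : ∀ x u, OffDiag e u → d (u * x) = d u * x + u * d x := fun x u hu => by
    have h := hg x u hu
    rw [H.defect_eq x hu, hc x u] at h
    rw [hdu _ (H.mul_right hu x), hdu u hu, hdx]
    linear_combination (norm := noncomm_ring) -h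
  have hdiag : ∀ x, x * e = e * x → d x * e = e * d x := fun x hx => by
    rw [hdx, sub_mul, mul_sub, H.map_commute hx, hc x e]
  intro x y
  obtain ⟨x, u, hx, hu, rfl⟩ := exists_diag_add_offDiag H.idem x
  obtain ⟨y, v, hy, hv, rfl⟩ := exists_diag_add_offDiag H.idem y
  have h0 : d (x * y) - d x * y - x * d y = 0 := by
    have hxy := hdiag (x * y) (by rw [mul_assoc, hy, ← mul_assoc, hx, mul_assoc])
    refine H.eq_zero_of_annihilates ?_ fun w hw => ⟨?_, ?_⟩
    · linear_combination (norm := noncomm_ring) hxy - d x * hy - hdiag x hx * y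
        - x * hdiag y hy - hx * d y
    · have a := hl (x * y) w hw
      rw [mul_assoc, hl x _ (H.mul_left hw y), hl y w hw] at a
      linear_combination (norm := noncomm_ring) -a
    · have a := hr (x * y) w hw
      rw [← mul_assoc, hr y _ (H.mul_right hw x), hr x w hw] at a
      linear_combination (norm := noncomm_ring) -a
  rw [add_mul, mul_add, mul_add, map_add, map_add, map_add, hl x v hv, hr y u hu, hl u v hv,
    map_add, map_add]
  linear_combination (norm := noncomm_ring) h0

end OffDiagLie

section LieNDeriv

variable {R A : Type*} [CommRing R] [Ring A] [Algebra R A]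

/-- The right-hand side of the Lie `(k+1)`-derivation identity. -/
def pComDeriv (φ : A →ₗ[R] A) (x : ℕ → A) (k : ℕ) : A :=
  ∑ i ∈ Finset.range (k + 1), pCom (Function.update x i (φ (x i))) k

lemma pCom_congr {x y : ℕ → A} {k : ℕ} (h : ∀ i ≤ k, x i = y i) : pCom x k = pCom y k := by
  induction k with
  | zero => exact h 0 le_rfl
  | succ k ih => simp only [pCom, ih fun i hi => h i (by omega), h (k + 1) le_rfl]

lemma pComDeriv_zero (φ : A →ₗ[R] A) (x : ℕ → A) : pComDeriv φ x 0 = φ (x 0) := by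
  simp [pComDeriv, pCom]

lemma pComDeriv_succ (φ : A →ₗ[R] A) (x : ℕ → A) (k : ℕ) :
    pComDeriv φ x (k + 1) =
      pComDeriv φ x k * x (k + 1) - x (k + 1) * pComDeriv φ x k +
        (pCom x k * φ (x (k + 1)) - φ (x (k + 1)) * pCom x k) := by
  unfold pComDeriv
  rw [Finset.sum_range_succ, Finset.sum_mul, Finset.mul_sum, ← Finset.sum_sub_distrib]
  congr 1
  · refine Finset.sum_congr rfl fun i hi => ?_
    have : k + 1 ≠ i := by have := Finset.mem_range.1 hi; omega
    simp only [pCom, Function.update_of_ne this]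
  · have : pCom (Function.update x (k + 1) (φ (x (k + 1)))) k = pCom x k :=
      pCom_congr fun i hi => Function.update_of_ne (by omega) _ _
    simp only [pCom, this, Function.update_self]

lemma isLieNDeriv_iff {n : ℕ} (hn : 2 ≤ n) (φ : A →ₗ[R] A) :
    IsLieNDeriv n φ ↔ ∀ x, φ (pCom x (n - 1)) = pComDeriv φ x (n - 1) := by
  unfold IsLieNDeriv pComDeriv
  rw [show n - 1 + 1 = n by omega]

lemma IsDeriv.map_pCom {d : A →ₗ[R] A} (hd : IsDeriv d) (x : ℕ → A) (k : ℕ) :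
    d (pCom x k) = pComDeriv d x k := by
  induction k with
  | zero => rw [pComDeriv_zero]; rfl
  | succ k ih =>
    rw [pComDeriv_succ, pCom, map_sub, hd, hd, ih]
    noncomm_ring

lemma pComDeriv_sub (φ ψ : A →ₗ[R] A) (x : ℕ → A) (k : ℕ) :
    pComDeriv (φ - ψ) x k = pComDeriv φ x k - pComDeriv ψ x k := by
  induction k with
  | zero => simp [pComDeriv_zero]
  | succ k ih =>
    simp only [pComDeriv_succ, ih, LinearMap.sub_apply]
    noncomm_ring

lemma pComDeriv_succ_of_central {γ : A →ₗ[R] A} (hγ : ∀ x, IsCent (γ x)) (x : ℕ → A) (k : ℕ) :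
    pComDeriv γ x (k + 1) = 0 := by
  induction k with
  | zero =>
    rw [pComDeriv_succ, pComDeriv_zero, hγ (x 0), hγ (x (0 + 1))]
    simp
  | succ k ih =>
    rw [pComDeriv_succ, ih, hγ (x (k + 1 + 1))]
    simp

lemma IsLieNDeriv.sub_isDeriv {n : ℕ} (hn : 2 ≤ n) {φ d : A →ₗ[R] A} (hφ : IsLieNDeriv n φ)
    (hd : IsDeriv d) : IsLieNDeriv n (φ - d) := by
  rw [isLieNDeriv_iff hn] at hφ ⊢
  intro x
  rw [pComDeriv_sub, LinearMap.sub_apply, hφ, hd.map_pCom]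

lemma IsLieNDeriv.isStandard {n : ℕ} (hn : 2 ≤ n) {φ d γ : A →ₗ[R] A} (hφ : IsLieNDeriv n φ)
    (hd : IsDeriv d) (hγ : ∀ x, IsCent (γ x)) (h : φ = d + γ) : IsStandardLieNDeriv n φ := by
  refine ⟨d, γ, hd, hγ, fun x => ?_, h⟩
  have hL := (isLieNDeriv_iff hn _).1 (hφ.sub_isDeriv hn hd) x
  rw [h, add_sub_cancel_left] at hL
  obtain ⟨k, hk⟩ : ∃ k, n - 1 = k + 1 := ⟨n - 2, by omega⟩
  rw [hL, hk, pComDeriv_succ_of_central hγ]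

/-- The sequence `u, v, e, e, …`. -/
def idemSeq (e u v : A) : ℕ → A
  | 0 => u
  | 1 => v
  | _ + 2 => e

variable {e : A}

lemma pCom_idemSeq_of_offDiag (he : e * e = e) {u : A} (hu : OffDiag e u) (j : ℕ) :
    pCom (idemSeq e u e) (2 * j) = u ∧
      pCom (idemSeq e u e) (2 * j + 1) = u * e - e * u := by
  have h1 : ∀ k, idemSeq e u e (k + 1) = e := fun k => by cases k <;> rfl
  induction j with
  | zero => exact ⟨rfl, rfl⟩
  | succ j ih =>
    have : pCom (idemSeq e u e) (2 * (j + 1)) = u := by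
      rw [show 2 * (j + 1) = 2 * j + 1 + 1 by ring, pCom, ih.2, h1,
        hu.commutator_commutator he]
    exact ⟨this, by rw [pCom, this, h1]⟩

lemma pComDeriv_idemSeq_of_offDiag (he : e * e = e) {φ : A →ₗ[R] A} (hc : φ e * e = e * φ e)
    {u : A} (hu : OffDiag e u) (huc : OffDiag e (u * φ e - φ e * u)) (j : ℕ) :
    pComDeriv φ (idemSeq e u e) (2 * j + 1) =
      (φ u * e - e * φ u) + (2 * j + 1) • (u * φ e - φ e * u) := by
  have h1 : ∀ k, idemSeq e u e (k + 1) = e := fun k => by cases k <;> rfl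
  induction j with
  | zero =>
    rw [pComDeriv_succ, pComDeriv_zero]
    simp [pCom, idemSeq]
  | succ j ih =>
    have hp := pCom_idemSeq_of_offDiag he hu
    have h3 := (offDiag_commutator he (φ u)).commutator_commutator he
    have h4 := huc.commutator_commutator he
    have h5 : ((u * e - e * u) * φ e - φ e * (u * e - e * u)) =
        (u * φ e - φ e * u) * e - e * (u * φ e - φ e * u) := by
      linear_combination (norm := noncomm_ring) hc * u - u * hc
    have hk := hp (j + 1)
    rw [show 2 * (j + 1) = 2 * j + 1 + 1 by ring] at hk ⊢
    rw [pComDeriv_succ, pComDeriv_succ, ih, h1, h1, hk.1, (hp j).2, h5]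
    generalize u * φ e - φ e * u = w at *
    generalize φ u * e - e * φ u = s at *
    have h6 : ∀ N : ℕ, ((s + N • w) * e - e * (s + N • w) + (w * e - e * w)) * e -
        e * ((s + N • w) * e - e * (s + N • w) + (w * e - e * w)) + w =
      s + (N + 1 + 1) • w := fun N => by
      have : ((s + N • w) * e - e * (s + N • w) + (w * e - e * w)) * e -
        e * ((s + N • w) * e - e * (s + N • w) + (w * e - e * w)) =
        ((s * e - e * s) * e - e * (s * e - e * s)) +
          (N + 1) • ((w * e - e * w) * e - e * (w * e - e * w)) := by
        simp only [nsmul_eq_mul, Nat.cast_add, Nat.cast_one]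
        have hN : e * (N : A) = N * e := (Nat.cast_commute N e).symm.eq
        simp only [mul_add, mul_sub, add_mul, sub_mul, one_mul, ← mul_assoc, hN]
        abel
      rw [this, h3, h4, succ_nsmul w (N + 1), add_assoc]
    exact h6 _

lemma IsLieNDeriv.map_idem_isCent {n : ℕ} (hn : 2 ≤ n) (hev : Even n) (he : e * e = e)
    (hn1 : TorsionFreeAt A (n - 1))
    (H0 : ∀ u v : A, OffDiag e u → OffDiag e v → u * v = 0)
    (hann : ∀ v : A, (∀ u, OffDiag e u → v * u = 0 ∧ u * v = 0) → OffDiag e v)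
    {φ : A →ₗ[R] A} (hφ : IsLieNDeriv n φ) (hc : φ e * e = e * φ e) : IsCent (φ e) := by
  obtain ⟨j, hj⟩ : ∃ j, n - 1 = 2 * j + 1 := by
    obtain ⟨k, hk⟩ := hev
    exact ⟨k - 1, by omega⟩
  rw [isLieNDeriv_iff hn] at hφ
  rw [hj] at hφ hn1
  have key : ∀ u, OffDiag e u →
      φ (u * e - e * u) = (φ u * e - e * φ u) + (2 * j + 1) • (u * φ e - φ e * u) := by
    intro u hu
    have huc : OffDiag e (u * φ e - φ e * u) :=
      (hu.mul_right he H0 _).sub (hu.mul_left he H0 _)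
    rw [← pComDeriv_idemSeq_of_offDiag he hc hu huc, ← hφ, (pCom_idemSeq_of_offDiag he hu j).2]
  have hl : ∀ m, e * m = m → m * e = 0 → φ e * m = m * φ e := by
    intro m m₁ m₂
    have k := key m (offDiag_of_mul_left m₁ m₂)
    rw [m₁, m₂, zero_sub, map_neg] at k
    have w₁ : e * (m * φ e - φ e * m) = m * φ e - φ e * m := by
      linear_combination (norm := noncomm_ring) m₁ * φ e - φ e * m₁ + hc * m
    have w₂ : (m * φ e - φ e * m) * e = 0 := by
      linear_combination (norm := noncomm_ring) m * hc + m₂ * φ e - φ e * m₂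
    generalize hw : m * φ e - φ e * m = w at *
    have z₁ : ((2 * j + 1) • w) * e = 0 := by rw [smul_mul_assoc, w₂, smul_zero]
    have z₂ : e * ((2 * j + 1) • w) = (2 * j + 1) • w := by rw [mul_smul_comm, w₁]
    refine (sub_eq_zero.1 (hw.trans (hn1 w ?_))).symm
    generalize (2 * j + 1) • w = W at *
    have h0 : e * φ m * e = 0 := by
      linear_combination (norm := noncomm_ring) -e * k * e - e * φ m * he + he * φ m * e - e * z₁
    linear_combination (norm := noncomm_ring) -e * k + he * φ m - h0 - z₂
  have hr : ∀ t, e * t = 0 → t * e = t → φ e * t = t * φ e := by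
    intro t t₁ t₂
    have k := key t (offDiag_of_mul_right t₁ t₂)
    rw [t₁, t₂, sub_zero] at k
    have w₁ : e * (t * φ e - φ e * t) = 0 := by
      linear_combination (norm := noncomm_ring) t₁ * φ e - φ e * t₁ + hc * t
    have w₂ : (t * φ e - φ e * t) * e = t * φ e - φ e * t := by
      linear_combination (norm := noncomm_ring) t * hc + t₂ * φ e - φ e * t₂
    generalize hw : t * φ e - φ e * t = w at *
    have z₁ : e * ((2 * j + 1) • w) = 0 := by rw [mul_smul_comm, w₁, smul_zero]
    have z₂ : ((2 * j + 1) • w) * e = (2 * j + 1) • w := by rw [smul_mul_assoc, w₂]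
    refine (sub_eq_zero.1 (hw.trans (hn1 w ?_))).symm
    generalize (2 * j + 1) • w = W at *
    have h0 : e * φ t * e = 0 := by
      linear_combination (norm := noncomm_ring) e * k * e + e * φ t * he - he * φ t * e + z₁ * e
    linear_combination (norm := noncomm_ring) -k * e - φ t * he + h0 - z₂
  refine isCent_of_commute_offDiag he H0 hann hc fun u hu => ?_
  have h0 := hu.corner he
  have a := hl (e * u) (by rw [← mul_assoc, he]) h0
  have b := hr (u * e) (by rw [← mul_assoc, h0]) (by rw [mul_assoc, he])
  unfold OffDiag at hu
  linear_combination (norm := noncomm_ring) a + b - φ e * hu + hu * φ e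

lemma pCom_idemSeq_odd (he : e * e = e) {φ : A →ₗ[R] A} (hc : IsCent (φ e)) {u v : A}
    (h₁ : OffDiag e (u * v - v * u))
    (h₂ : OffDiag e (φ u * v - v * φ u + (u * φ v - φ v * u))) (j : ℕ) :
    pCom (idemSeq e u v) (2 * j + 1) = u * v - v * u ∧
      pComDeriv φ (idemSeq e u v) (2 * j + 1) = φ u * v - v * φ u + (u * φ v - φ v * u) := by
  have hx : ∀ k, idemSeq e u v (k + 1 + 1) = e := fun _ => rfl
  induction j with
  | zero =>
    rw [pComDeriv_succ, pComDeriv_zero]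
    exact ⟨rfl, rfl⟩
  | succ j ih =>
    rw [show 2 * (j + 1) + 1 = 2 * j + 1 + 1 + 1 by ring]
    constructor
    · rw [pCom, pCom, ih.1, hx, hx, h₁.commutator_commutator he]
    · rw [pComDeriv_succ, pComDeriv_succ, ih.2, hx, hx, hc, hc, sub_self, sub_self, add_zero,
        add_zero, h₂.commutator_commutator he]

lemma IsLieNDeriv.map_of_offDiag {n : ℕ} (hn : 2 ≤ n) (hev : Even n) (he : e * e = e)
    {φ : A →ₗ[R] A} (hφ : IsLieNDeriv n φ) (hc : IsCent (φ e)) {u v : A}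
    (h₁ : OffDiag e (u * v - v * u))
    (h₂ : OffDiag e (φ u * v - v * φ u + (u * φ v - φ v * u))) :
    φ (u * v - v * u) = φ u * v - v * φ u + (u * φ v - φ v * u) := by
  obtain ⟨j, hj⟩ : ∃ j, n - 1 = 2 * j + 1 := by
    obtain ⟨k, hk⟩ := hev
    exact ⟨k - 1, by omega⟩
  rw [isLieNDeriv_iff hn, hj] at hφ
  have h := pCom_idemSeq_odd he hc h₁ h₂ j
  rw [← h.2, ← hφ, h.1]

lemma IsLieNDeriv.offDiagLie {n : ℕ} (hn : 2 ≤ n) (hev : Even n) (he : e * e = e)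
    (h2 : TorsionFreeAt A 2) (hn1 : TorsionFreeAt A (n - 1))
    (H0 : ∀ u v : A, OffDiag e u → OffDiag e v → u * v = 0)
    (hann : ∀ v : A, (∀ u, OffDiag e u → v * u = 0 ∧ u * v = 0) → OffDiag e v)
    {φ : A →ₗ[R] A} (hφ : IsLieNDeriv n φ) (hc : φ e * e = e * φ e) : OffDiagLie e φ := by
  have hcent := hφ.map_idem_isCent hn hev he hn1 H0 hann hc
  have hcomm : ∀ x, φ (x * e - e * x) = φ x * e - e * φ x := by
    intro x
    have h := hφ.map_of_offDiag hn hev he hcent (offDiag_commutator he x) (v := e)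
    rw [hcent x, sub_self, add_zero] at h
    exact h (offDiag_commutator he _)
  refine ⟨he, h2, H0, hann, hcomm, fun x u hu => ?_⟩
  have hφu : OffDiag e (φ u) := by
    rw [← hu.commutator_commutator he, hcomm]
    exact offDiag_commutator he _
  exact hφ.map_of_offDiag hn hev he hcent ((hu.mul_left he H0 x).sub (hu.mul_right he H0 x))
    (((hu.mul_left he H0 _).sub (hu.mul_right he H0 _)).add
      ((hφu.mul_left he H0 x).sub (hφu.mul_right he H0 x)))

/-- The inner derivation `x ↦ [x, s]`. -/
def innerDeriv (R : Type*) {A : Type*} [CommRing R] [Ring A] [Algebra R A] (s : A) : A →ₗ[R] A :=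
  LinearMap.mulRight R s - LinearMap.mulLeft R s

lemma innerDeriv_apply (s x : A) : innerDeriv R s x = x * s - s * x := rfl

lemma isDeriv_innerDeriv (s : A) : IsDeriv (innerDeriv R s) := fun x y => by
  simp only [innerDeriv_apply]
  noncomm_ring

theorem IsLieNDeriv.isStandard_of_even {n : ℕ} (hn : 2 ≤ n) (hev : Even n) (he : e * e = e)
    (h2 : TorsionFreeAt A 2) (hn1 : TorsionFreeAt A (n - 1))
    (H0 : ∀ u v : A, OffDiag e u → OffDiag e v → u * v = 0)
    (hann : ∀ v : A, (∀ u, OffDiag e u → v * u = 0 ∧ u * v = 0) → OffDiag e v)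
    (hSA : ∀ x : A, x ∈ NonUnitalAlgebra.adjoin R
      ({y : A | y * y = y} ∪ {y : A | ∃ a b : A, y = a * b - b * a}))
    {φ : A →ₗ[R] A} (hφ : IsLieNDeriv n φ) : IsStandardLieNDeriv n φ := by
  have hi := isDeriv_innerDeriv (R := R) (e * φ e - φ e * e)
  have hc : (φ - innerDeriv R (e * φ e - φ e * e)) e * e =
      e * (φ - innerDeriv R (e * φ e - φ e * e)) e := by
    rw [LinearMap.sub_apply, innerDeriv_apply]
    linear_combination (norm := noncomm_ring) -φ e * e * he - φ e * he + e * he * φ e + he * φ e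
      - 3 * he * φ e * e + 3 * e * φ e * he
  obtain ⟨d, γ, hd, hγ, h⟩ := ((hφ.sub_isDeriv hn hi).offDiagLie hn hev he h2 hn1 H0 hann
    hc).exists_deriv_add_central hSA
  refine hφ.isStandard hn (d := d + innerDeriv R (e * φ e - φ e * e)) (γ := γ) (fun x y => ?_) hγ ?_
  · rw [LinearMap.add_apply, LinearMap.add_apply, LinearMap.add_apply, hd, hi]
    noncomm_ring
  · rw [add_right_comm, ← h, sub_add_cancel]

end LieNDeriv

theorem stmt_13 (R : Type*) [CommRing R] (A : Type*) [Ring A] [Algebra R A]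
    (n : ℕ) (hn : 2 ≤ n)
    (h2 : TorsionFreeAt A 2) (hn1 : TorsionFreeAt A (n - 1))
    (e : A) (he : e * e = e) (he0 : e ≠ 0) (he1 : e ≠ 1) (hQ : PropQ e)
    (hSA : ∀ x : A, x ∈ NonUnitalAlgebra.adjoin R
      ({y : A | y * y = y} ∪ {y : A | ∃ a b : A, y = a * b - b * a}))
    (hyp :
      (Even n ∧
        (∀ m t : A, (e * m * (1 - e)) * ((1 - e) * t * e) = 0 ∧
          ((1 - e) * t * e) * (e * m * (1 - e)) = 0)) ∨
      (∀ x : A, e * x * (1 - e) = 0 ∧ (1 - e) * x * e = 0)) :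
    ∀ φ : A →ₗ[R] A, IsLieNDeriv n φ → IsStandardLieNDeriv n φ := by
  intro φ hφ
  have hann := fun v => hQ.offDiag_of_annihilates (v := v) he
  rcases hyp with ⟨hev, H⟩ | H
  · exact hφ.isStandard_of_even hn hev he h2 hn1
      (fun u v hu hv => hu.mul_eq_zero he H hv) hann hSA
  · have h : e * 1 * e = 0 :=
      hQ.1 1 ⟨fun y => by rw [(H y).1, mul_zero], fun y => by rw [(H y).2, zero_mul]⟩
    rw [mul_one, he] at h
    exact absurd h he0
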